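/- Z₀ is contained in the center of 𝓛(ε), and the ℂ-algebra homomorphism ψ : ℂ[x₁,x₂,x₃,x₄] → 𝓛(ε) determined by ψ(x₁) = T_l(ω) − d^l, ψ(x₂) = b^l, ψ(x₃) = c^l, ψ(x₄) = d^l has image Z₀ and kernel the ideal generated by x₁x₄ − x₂x₃ − 1; consequently Z₀ is isomorphic as a ℂ-algebra to the coordinate ring 𝓞(SL₂(ℂ)) = ℂ[x₁,x₂,x₃,x₄]/(x₁x₄ − x₂x₃ − 1). -/

import Mathlib

set_option synthInstance.maxHeartbeats 1000000

noncomputable section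

variable (R : Type*) [CommRing R]

/-- Generators. -/
def gA : FreeAlgebra R (Fin 4) := FreeAlgebra.ι R 0
def gB : FreeAlgebra R (Fin 4) := FreeAlgebra.ι R 1
def gC : FreeAlgebra R (Fin 4) := FreeAlgebra.ι R 2
def gD : FreeAlgebra R (Fin 4) := FreeAlgebra.ι R 3

/-- Defining relations of 𝓛₀,₁, with `s` standing for `q²` and `t` for `q⁻²`. -/
inductive LRel (s t : R) : FreeAlgebra R (Fin 4) → FreeAlgebra R (Fin 4) → Prop
  | rel1 : LRel s t (gA R * gD R) (gD R * gA R)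
  | rel2 : LRel s t (gA R * gB R - gB R * gA R)
      (-(algebraMap R (FreeAlgebra R (Fin 4)) (1 - t) * (gB R * gD R)))
  | rel3 : LRel s t (gD R * gB R) (algebraMap R (FreeAlgebra R (Fin 4)) s * (gB R * gD R))
  | rel4 : LRel s t (gC R * gB R - gB R * gC R)
      (algebraMap R (FreeAlgebra R (Fin 4)) (1 - t) * (gD R * gA R - gD R * gD R))
  | rel5 : LRel s t (gC R * gD R) (algebraMap R (FreeAlgebra R (Fin 4)) s * (gD R * gC R))
  | rel6 : LRel s t (gA R * gC R - gC R * gA R)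
      (algebraMap R (FreeAlgebra R (Fin 4)) (1 - t) * (gD R * gC R))
  | rel7 : LRel s t (gA R * gD R - algebraMap R (FreeAlgebra R (Fin 4)) s * (gB R * gC R)) 1

/-- The quantum loop algebra with parameters `s = q²`, `t = q⁻²`. -/
def QLoop (s t : R) : Type _ := RingQuot (LRel R s t)

instance (s t : R) : Ring (QLoop R s t) := RingQuot.instRing _
instance (s t : R) : Algebra R (QLoop R s t) := RingQuot.instAlgebra _

/-- The generators a, b, c, d of the quantum loop algebra. -/
def qa (s t : R) : QLoop R s t := RingQuot.mkAlgHom R (LRel R s t) (gA R)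
def qb (s t : R) : QLoop R s t := RingQuot.mkAlgHom R (LRel R s t) (gB R)
def qc (s t : R) : QLoop R s t := RingQuot.mkAlgHom R (LRel R s t) (gC R)
def qd (s t : R) : QLoop R s t := RingQuot.mkAlgHom R (LRel R s t) (gD R)

/-- The specialization 𝓛(q₀) at q = q₀ ∈ ℂ. -/
def Lspec (q₀ : ℂ) : Type := QLoop ℂ (q₀ ^ 2) ((q₀ ^ 2)⁻¹)

instance (q₀ : ℂ) : Ring (Lspec q₀) := inferInstanceAs (Ring (QLoop ℂ _ _))
instance (q₀ : ℂ) : Algebra ℂ (Lspec q₀) := inferInstanceAs (Algebra ℂ (QLoop ℂ _ _))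


/-- The generators a, b, c, d of 𝓛(q₀). -/
def la (q₀ : ℂ) : Lspec q₀ := qa ℂ (q₀ ^ 2) ((q₀ ^ 2)⁻¹)
def lb (q₀ : ℂ) : Lspec q₀ := qb ℂ (q₀ ^ 2) ((q₀ ^ 2)⁻¹)
def lc (q₀ : ℂ) : Lspec q₀ := qc ℂ (q₀ ^ 2) ((q₀ ^ 2)⁻¹)
def ld (q₀ : ℂ) : Lspec q₀ := qd ℂ (q₀ ^ 2) ((q₀ ^ 2)⁻¹)

/-- The central element ω := q₀·a + q₀⁻¹·d of 𝓛(q₀). -/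
def omegaL (q₀ : ℂ) : Lspec q₀ :=
  algebraMap ℂ (Lspec q₀) q₀ * la q₀ + algebraMap ℂ (Lspec q₀) q₀⁻¹ * ld q₀

section QuadraticGWA

variable {k A : Type*} [Field k] [Ring A] [Algebra k A]

/-- The quadratic expression in `x` which equals `b * c` in `𝓛(q)` for `w = ω` and `x = d`. -/
def loopQuad (q : k) (w x : A) : A :=
  (q⁻¹ ^ 3) • (w * x) - (q⁻¹ ^ 4) • (x * x) - (q⁻¹ ^ 2) • (1 : A)

theorem mul_loopQuad {q r : k} {w z d : A} (hw : Commute w z) (hd : z * d = r • (d * z)) :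
    z * loopQuad q w d = loopQuad q w (r • d) * z := by
  have h1 : z * (w * d) = r • (w * d * z) := by
    rw [← mul_assoc, ← hw.eq, mul_assoc, hd, mul_smul_comm, mul_assoc]
  have h2 : z * (d * d) = (r * r) • (d * d * z) := by
    rw [← mul_assoc, hd, smul_mul_assoc, mul_assoc, hd, mul_smul_comm, smul_smul, mul_assoc]
  simp only [loopQuad, mul_sub, sub_mul, mul_smul_comm, smul_mul_assoc, h1, h2, smul_smul,
    mul_one, one_mul]

theorem pow_mul_eq_smul_mul_pow {r : k} {z d : A} (hd : z * d = r • (d * z)) (n : ℕ) :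
    z ^ n * d = r ^ n • (d * z ^ n) := by
  induction n with
  | zero => simp
  | succ n ih =>
    rw [pow_succ, mul_assoc, hd, mul_smul_comm, ← mul_assoc, ih, smul_mul_assoc, smul_smul,
      mul_assoc, ← pow_succ']

theorem mul_pow_eq_smul_pow_mul {r : k} {z d : A} (hd : z * d = r • (d * z)) (n : ℕ) :
    z * d ^ n = r ^ n • (d ^ n * z) := by
  induction n with
  | zero => simp
  | succ n ih =>
    rw [pow_succ, ← mul_assoc, ih, smul_mul_assoc, mul_assoc, hd, mul_smul_comm, smul_smul,
      mul_assoc, ← pow_succ]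

theorem commute_pow_of_loopQuad {q r : k} {w d y z : A} {l : ℕ} (hl : 0 < l) (hr : r ^ l = 1)
    (hw : Commute w y) (hd : y * d = r • (d * y))
    (hyz : y * z = loopQuad q w d) (hzy : z * y = loopQuad q w (r⁻¹ • d)) :
    Commute (y ^ l) z := by
  obtain ⟨n, rfl⟩ : ∃ n, l = n + 1 := ⟨l - 1, by omega⟩
  have hr' : r ^ n = r⁻¹ := eq_inv_of_mul_eq_one_left (by rwa [← pow_succ])
  rw [Commute, SemiconjBy, pow_succ, mul_assoc, hyz,
    mul_loopQuad (hw.pow_right n) (pow_mul_eq_smul_mul_pow hd n), hr', ← hzy, mul_assoc,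
    ← pow_succ', pow_succ]

end QuadraticGWA

theorem exists_add_inv_eq (w : ℂ) : ∃ u : ℂ, u ≠ 0 ∧ u + u⁻¹ = w := by
  obtain ⟨u, hu⟩ := IsAlgClosed.exists_root
    (Polynomial.X ^ 2 - Polynomial.C w * Polynomial.X + 1 : Polynomial ℂ) (by
      have : (Polynomial.X ^ 2 - Polynomial.C w * Polynomial.X + 1 : Polynomial ℂ).degree = 2 := by
        compute_degree!
      rw [this]; decide)
  have hu' : u ^ 2 - w * u + 1 = 0 := by simpa [Polynomial.IsRoot] using hu
  have hu0 : u ≠ 0 := by rintro rfl; simp at hu'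
  exact ⟨u, hu0, by field_simp; linear_combination hu'⟩

theorem prod_loopQuad_complex {l : ℕ} (hodd : Odd l) {ε : ℂ} (hε : IsPrimitiveRoot ε l)
    {P : Polynomial ℤ}
    (hP : ∀ u : ℂ, u ≠ 0 → Polynomial.aeval (u + u⁻¹) P = u ^ l + u⁻¹ ^ l) (w x : ℂ) :
    ∏ i ∈ Finset.range l, loopQuad ε w ((ε⁻¹ ^ 2) ^ i • x) =
      Polynomial.aeval w P * x ^ l - x ^ l * x ^ l - 1 := by
  have hl : 0 < l := hodd.pos
  have hε0 : ε ≠ 0 := hε.ne_zero hl.ne'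
  obtain ⟨u, hu0, hw⟩ := exists_add_inv_eq w
  have ht : IsPrimitiveRoot (ε⁻¹ ^ 2) l :=
    hε.inv.pow_of_coprime 2 (Nat.coprime_two_left.mpr hodd)
  have hprod (y : ℂ) : ∏ i ∈ Finset.range l, (y - (ε⁻¹ ^ 2) ^ i * x) = y ^ l - x ^ l := by
    have := congrArg (Polynomial.eval y) (X_pow_sub_C_eq_prod ht hl (rfl : x ^ l = x ^ l))
    simpa [Polynomial.eval_prod] using this.symm
  have hfac (i : ℕ) : loopQuad ε w ((ε⁻¹ ^ 2) ^ i • x) =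
      -(ε⁻¹ ^ 4) * ((ε * u - (ε⁻¹ ^ 2) ^ i * x) * (ε * u⁻¹ - (ε⁻¹ ^ 2) ^ i * x)) := by
    simp only [loopQuad, smul_eq_mul, ← hw]
    generalize (ε⁻¹ ^ 2) ^ i * x = y
    field_simp
    ring
  have hε4 : (-(ε⁻¹ ^ 4)) ^ l = -1 := by
    rw [hodd.neg_pow, ← pow_mul, mul_comm, pow_mul, inv_pow, hε.pow_eq_one]; simp
  simp only [hfac, Finset.prod_mul_distrib, hprod, Finset.prod_const, Finset.card_range, hε4]
  rw [← hw, hP u hu0, mul_pow, mul_pow, hε.pow_eq_one, inv_pow]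
  field_simp
  ring

theorem AlgHom.map_aeval_int {k B C : Type*} [CommRing k] [Ring B] [Ring C] [Algebra k B]
    [Algebra k C] [Algebra ℤ B] [Algebra ℤ C] (f : B →ₐ[k] C) (x : B) (P : Polynomial ℤ) :
    f (Polynomial.aeval x P) = Polynomial.aeval (f x) P :=
  by
  simpa using (Polynomial.aeval_algHom_apply
    ({ f.toRingHom with commutes' := fun n => by simp } : B →ₐ[ℤ] C) x P).symm

theorem prod_loopQuad {B : Type*} [CommRing B] [Algebra ℂ B] {l : ℕ} (hodd : Odd l) {ε : ℂ}
    (hε : IsPrimitiveRoot ε l) {P : Polynomial ℤ}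
    (hP : ∀ u : ℂ, u ≠ 0 → Polynomial.aeval (u + u⁻¹) P = u ^ l + u⁻¹ ^ l) (w x : B) :
    ∏ i ∈ Finset.range l, loopQuad ε w ((ε⁻¹ ^ 2) ^ i • x) =
      Polynomial.aeval w P * x ^ l - x ^ l * x ^ l - 1 := by
  have key : ∏ i ∈ Finset.range l, loopQuad ε (MvPolynomial.X 0 : MvPolynomial (Fin 2) ℂ)
      ((ε⁻¹ ^ 2) ^ i • MvPolynomial.X 1) =
      Polynomial.aeval (MvPolynomial.X 0) P * MvPolynomial.X 1 ^ l
        - MvPolynomial.X 1 ^ l * MvPolynomial.X 1 ^ l - 1 := by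
    refine MvPolynomial.funext fun v => ?_
    have := prod_loopQuad_complex hodd hε hP (v 0) (v 1)
    simp only [loopQuad] at this ⊢
    rw [← MvPolynomial.coe_aeval_eq_eval]
    change MvPolynomial.aeval v _ = MvPolynomial.aeval v _
    simpa only [map_prod, map_sub, map_mul, map_smul, map_one, map_pow, MvPolynomial.aeval_X,
      AlgHom.map_aeval_int] using this
  have := congrArg (MvPolynomial.aeval (R := ℂ) ![w, x]) key
  simpa [loopQuad, map_prod, AlgHom.map_aeval_int] using this

section QuadraticGWA

variable {A : Type*} [Ring A] [Algebra ℂ A]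

theorem pow_mul_pow_eq_of_loopQuad {l : ℕ} (hodd : Odd l) {ε : ℂ}
    (hε : IsPrimitiveRoot ε l) {P : Polynomial ℤ}
    (hP : ∀ u : ℂ, u ≠ 0 → Polynomial.aeval (u + u⁻¹) P = u ^ l + u⁻¹ ^ l)
    {w b c d : A} (hw : w ∈ Subalgebra.center ℂ A) (hbd : b * d = (ε⁻¹ ^ 2) • (d * b))
    (hbc : b * c = loopQuad ε w d) :
    b ^ l * c ^ l = Polynomial.aeval w P * d ^ l - d ^ l * d ^ l - 1 := by
  let Z := Subalgebra.center ℂ A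
  let φ : Polynomial Z →ₐ[ℂ] A := Polynomial.eval₂AlgHom Z.val d fun z =>
    (Subalgebra.mem_center_iff.mp z.2 d).symm
  let W : Polynomial Z := Polynomial.C ⟨w, hw⟩
  have hφW : φ W = w := Polynomial.eval₂_C _ _
  have hφX : φ Polynomial.X = d := Polynomial.eval₂_X _ _
  have hφquad (r : ℂ) : φ (loopQuad ε W (r • Polynomial.X)) = loopQuad ε w (r • d) := by
    simp only [loopQuad, map_sub, map_mul, map_smul, map_one, hφW, hφX]
  have hpow (n : ℕ) : b ^ n * c ^ n =
      φ (∏ i ∈ Finset.range n, loopQuad ε W ((ε⁻¹ ^ 2) ^ i • Polynomial.X)) := by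
    induction n with
    | zero => simp
    | succ n ih =>
      have hwb : Commute w (b ^ n) := (Subalgebra.mem_center_iff.mp hw (b ^ n)).symm
      rw [Finset.prod_range_succ, mul_comm, map_mul, ← ih, hφquad, ← mul_assoc,
        ← mul_loopQuad hwb (pow_mul_eq_smul_mul_pow hbd n), ← hbc, pow_succ, pow_succ' c]
      simp only [mul_assoc]
  rw [hpow]
  have h : φ (Polynomial.aeval W P * Polynomial.X ^ l
      - Polynomial.X ^ l * Polynomial.X ^ l - 1) =
      Polynomial.aeval w P * d ^ l - d ^ l * d ^ l - 1 := by
    simp only [map_sub, map_mul, map_pow, map_one, AlgHom.map_aeval_int, hφX, hφW]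
  exact (congrArg φ (prod_loopQuad hodd hε hP W Polynomial.X)).trans h

end QuadraticGWA

section DetIdeal

open MvPolynomial

/-- The determinant relation cutting `SL₂` out of affine 4-space. -/
def detPoly : MvPolynomial (Fin 4) ℂ := X 0 * X 3 - X 1 * X 2 - 1

theorem exists_X_one_pow_mul_sub_rename_mem (p : MvPolynomial (Fin 4) ℂ) :
    ∃ (N : ℕ) (r : MvPolynomial (Fin 3) ℂ),
      X 1 ^ N * p - rename ![0, 1, 3] r ∈ Ideal.span {detPoly} := by
  induction p using MvPolynomial.induction_on with
  | C a => exact ⟨0, C a, by simp⟩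
  | add p q hp hq =>
    obtain ⟨N, r, h⟩ := hp
    obtain ⟨M, t, h'⟩ := hq
    refine ⟨N + M, X 1 ^ M * r + X 1 ^ N * t, ?_⟩
    convert add_mem (Ideal.mul_mem_left _ (X 1 ^ M) h) (Ideal.mul_mem_left _ (X 1 ^ N) h') using 1
    simp
    ring
  | mul_X p i hp =>
    obtain ⟨N, r, h⟩ := hp
    fin_cases i
    · exact ⟨N, r * X 0, by convert Ideal.mul_mem_right (X 0) _ h using 1; simp; ring⟩
    · exact ⟨N, r * X 1, by convert Ideal.mul_mem_right (X 1) _ h using 1; simp; ring⟩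
    · refine ⟨N + 1, r * (X 0 * X 2 - 1), ?_⟩
      convert sub_mem (Ideal.mul_mem_right (X 0 * X 3 - 1) _ h)
        (Ideal.mul_mem_left _ (X 1 ^ N * p) (Ideal.mem_span_singleton_self detPoly)) using 1
      simp [detPoly]
      ring
    · exact ⟨N, r * X 2, by convert Ideal.mul_mem_right (X 3) _ h using 1; simp; ring⟩

theorem mem_span_detPoly_of_X_one_mul_mem {p : MvPolynomial (Fin 4) ℂ}
    (h : X 1 * p ∈ Ideal.span {detPoly}) : p ∈ Ideal.span {detPoly} := by
  rw [Ideal.mem_span_singleton] at h ⊢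
  obtain ⟨g, hg⟩ := h
  have hX : ¬ (X 1 ∣ detPoly) := by
    rintro ⟨k, hk⟩
    simpa [detPoly] using congrArg (eval 0) hk
  obtain ⟨k, rfl⟩ := ((X_prime (i := 1)).dvd_or_dvd ⟨p, hg.symm⟩).resolve_left hX
  exact ⟨k, mul_left_cancel₀ (X_ne_zero 1) (by rw [hg]; ring)⟩

theorem mem_span_detPoly_of_eval_eq_zero {p : MvPolynomial (Fin 4) ℂ}
    (h : ∀ v : Fin 4 → ℂ, v 1 ≠ 0 → v 0 * v 3 - v 1 * v 2 = 1 → eval v p = 0) :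
    p ∈ Ideal.span {detPoly} := by
  obtain ⟨N, r, hr⟩ := exists_X_one_pow_mul_sub_rename_mem p
  have hr0 : r = 0 := by
    refine (mul_eq_zero.mp (?_ : X 1 * r = 0)).resolve_left (X_ne_zero 1)
    refine MvPolynomial.funext fun v => ?_
    by_cases hv : v 1 = 0
    · simp [hv]
    obtain ⟨g, hg⟩ := Ideal.mem_span_singleton.mp hr
    let v' : Fin 4 → ℂ := ![v 0, v 1, (v 0 * v 2 - 1) / v 1, v 2]
    have hdet : v' 0 * v' 3 - v' 1 * v' 2 = 1 := by
      simp [v']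
      field_simp
      ring
    have hcomp : v' ∘ ![0, 1, 3] = v := by
      ext i
      fin_cases i <;> simp [v']
    have hev := congrArg (eval v') hg
    simp only [detPoly, map_sub, map_mul, map_pow, eval_X, map_one, h v' hv hdet, hdet,
      eval_rename, hcomp] at hev
    have : eval v r = 0 := by simpa using hev
    simp [this]
  rw [hr0, map_zero, sub_zero] at hr
  clear hr0 h
  induction N with
  | zero => simpa using hr
  | succ n ih => exact ih (mem_span_detPoly_of_X_one_mul_mem (by rwa [← mul_assoc, ← pow_succ']))

end DetIdeal

section Lspec

theorem Lspec.commute_of_generators {q : ℂ} {x : Lspec q} (ha : Commute x (la q))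
    (hb : Commute x (lb q)) (hc : Commute x (lc q)) (hd : Commute x (ld q)) (y : Lspec q) :
    Commute x y := by
  obtain ⟨z, rfl⟩ := RingQuot.mkAlgHom_surjective ℂ (LRel ℂ (q ^ 2) ((q ^ 2)⁻¹)) y
  induction z using FreeAlgebra.induction with
  | grade0 r =>
    rw [AlgHom.commutes]
    exact (Algebra.commutes r x).symm
  | grade1 i => fin_cases i <;> assumption
  | mul z z' h h' =>
    rw [map_mul]
    exact h.mul_right h'
  | add z z' h h' =>
    rw [map_add]
    exact h.add_right h'

variable {q : ℂ}

theorem la_mul_ld : la q * ld q = ld q * la q := by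
  have := RingQuot.mkAlgHom_rel ℂ (LRel.rel1 (s := q ^ 2) (t := (q ^ 2)⁻¹))
  simp only [map_mul] at this
  exact this

theorem la_mul_lb :
    la q * lb q - lb q * la q = -((1 - (q ^ 2)⁻¹) • (lb q * ld q)) := by
  have := RingQuot.mkAlgHom_rel ℂ (LRel.rel2 (s := q ^ 2) (t := (q ^ 2)⁻¹))
  simp only [← Algebra.smul_def] at this
  simp only [map_mul, map_smul, map_sub, map_neg] at this
  exact this

theorem ld_mul_lb : ld q * lb q = q ^ 2 • (lb q * ld q) := by
  have := RingQuot.mkAlgHom_rel ℂ (LRel.rel3 (s := q ^ 2) (t := (q ^ 2)⁻¹))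
  simp only [← Algebra.smul_def] at this
  simp only [map_smul, map_mul] at this
  exact this

theorem lc_mul_lb : lc q * lb q - lb q * lc q =
    (1 - (q ^ 2)⁻¹) • (ld q * la q - ld q * ld q) := by
  have := RingQuot.mkAlgHom_rel ℂ (LRel.rel4 (s := q ^ 2) (t := (q ^ 2)⁻¹))
  simp only [← Algebra.smul_def] at this
  simp only [map_smul, map_sub, map_mul] at this
  exact this

theorem lc_mul_ld : lc q * ld q = q ^ 2 • (ld q * lc q) := by
  have := RingQuot.mkAlgHom_rel ℂ (LRel.rel5 (s := q ^ 2) (t := (q ^ 2)⁻¹))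
  simp only [← Algebra.smul_def] at this
  simp only [map_smul, map_mul] at this
  exact this

theorem la_mul_lc : la q * lc q - lc q * la q = (1 - (q ^ 2)⁻¹) • (ld q * lc q) := by
  have := RingQuot.mkAlgHom_rel ℂ (LRel.rel6 (s := q ^ 2) (t := (q ^ 2)⁻¹))
  simp only [← Algebra.smul_def] at this
  simp only [map_smul, map_sub, map_mul] at this
  exact this

theorem la_mul_ld_sub : la q * ld q - q ^ 2 • (lb q * lc q) = 1 := by
  have := RingQuot.mkAlgHom_rel ℂ (LRel.rel7 (s := q ^ 2) (t := (q ^ 2)⁻¹))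
  simp only [← Algebra.smul_def] at this
  simp only [map_smul, map_sub, map_mul, map_one] at this
  exact this

theorem omegaL_eq : omegaL q = q • la q + q⁻¹ • ld q := by
  rw [omegaL, Algebra.smul_def, Algebra.smul_def]

theorem la_eq (hq : q ≠ 0) : la q = q⁻¹ • omegaL q - (q⁻¹ ^ 2) • ld q := by
  rw [omegaL_eq]
  match_scalars <;> field_simp
  simp

theorem lb_mul_ld (hq : q ≠ 0) : lb q * ld q = (q⁻¹ ^ 2) • (ld q * lb q) := by
  rw [ld_mul_lb, smul_smul, ← mul_pow, inv_mul_cancel₀ hq, one_pow, one_smul]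

theorem omegaL_mem_center (hq : q ≠ 0) : omegaL q ∈ Subalgebra.center ℂ (Lspec q) := by
  rw [Subalgebra.mem_center_iff]
  intro y
  refine (Lspec.commute_of_generators ?_ ?_ ?_ ?_ y).symm <;>
    rw [omegaL_eq, Commute, SemiconjBy] <;>
    simp only [add_mul, mul_add, smul_mul_assoc, mul_smul_comm]
  · rw [la_mul_ld]
  · rw [eq_add_of_sub_eq la_mul_lb, ld_mul_lb]
    match_scalars <;> field_simp
    ring
  · rw [eq_add_of_sub_eq la_mul_lc, lc_mul_ld]
    match_scalars <;> field_simp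
    ring
  · rw [la_mul_ld]

theorem commute_omegaL (hq : q ≠ 0) (y : Lspec q) : Commute (omegaL q) y :=
  (Subalgebra.mem_center_iff.mp (omegaL_mem_center hq) y).symm

theorem lb_mul_lc (hq : q ≠ 0) : lb q * lc q = loopQuad q (omegaL q) (ld q) := by
  have h : lb q * lc q = (q⁻¹ ^ 2) • (la q * ld q - 1) := by
    rw [← la_mul_ld_sub, sub_sub_cancel, smul_smul, ← mul_pow, inv_mul_cancel₀ hq, one_pow,
      one_smul]
  rw [h, la_eq hq, loopQuad]
  simp only [sub_mul, smul_mul_assoc]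
  module

theorem lc_mul_lb_eq (hq : q ≠ 0) :
    lc q * lb q = loopQuad q (omegaL q) (q ^ 2 • ld q) := by
  rw [eq_add_of_sub_eq lc_mul_lb, lb_mul_lc hq, ← la_mul_ld, la_eq hq, loopQuad, loopQuad]
  simp only [sub_mul, smul_mul_assoc, mul_smul_comm]
  match_scalars <;> field_simp
  all_goals ring

theorem Lspec.mem_center_of_commute (hq : q ≠ 0) {x : Lspec q} (hb : Commute x (lb q))
    (hc : Commute x (lc q)) (hd : Commute x (ld q)) : x ∈ Subalgebra.center ℂ (Lspec q) := by
  rw [Subalgebra.mem_center_iff]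
  refine fun y => (Lspec.commute_of_generators ?_ hb hc hd y).symm
  rw [la_eq hq]
  exact ((commute_omegaL hq x).symm.smul_right _).sub_right (hd.smul_right _)

variable {l : ℕ}

theorem lb_pow_mem_center (hl : 0 < l) (hq : q ≠ 0) (hql : q ^ l = 1) :
    lb q ^ l ∈ Subalgebra.center ℂ (Lspec q) := by
  refine Lspec.mem_center_of_commute hq ((Commute.refl _).pow_left l) ?_ ?_
  · refine commute_pow_of_loopQuad hl (r := q⁻¹ ^ 2) (by simp [pow_right_comm _ 2, hql])
      (commute_omegaL hq _) (lb_mul_ld hq) (lb_mul_lc hq) ?_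
    rw [lc_mul_lb_eq hq, inv_pow, inv_inv]
  · rw [Commute, SemiconjBy, pow_mul_eq_smul_mul_pow (lb_mul_ld hq), pow_right_comm, inv_pow, hql]
    simp

theorem lc_pow_mem_center (hl : 0 < l) (hq : q ≠ 0) (hql : q ^ l = 1) :
    lc q ^ l ∈ Subalgebra.center ℂ (Lspec q) := by
  refine Lspec.mem_center_of_commute hq ?_ ((Commute.refl _).pow_left l) ?_
  · refine commute_pow_of_loopQuad hl (r := q ^ 2) (d := q ^ 2 • ld q)
      (by simp [pow_right_comm _ 2, hql])
      (commute_omegaL hq _) ?_ (lc_mul_lb_eq hq) ?_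
    · rw [mul_smul_comm, lc_mul_ld, smul_mul_assoc]
    · rw [lb_mul_lc hq, smul_smul, inv_mul_cancel₀ (pow_ne_zero 2 hq), one_smul]
  · rw [Commute, SemiconjBy, pow_mul_eq_smul_mul_pow lc_mul_ld, pow_right_comm, hql]
    simp

theorem ld_pow_mem_center (hq : q ≠ 0) (hql : q ^ l = 1) :
    ld q ^ l ∈ Subalgebra.center ℂ (Lspec q) := by
  refine Lspec.mem_center_of_commute hq (Commute.symm ?_) (Commute.symm ?_)
    ((Commute.refl _).pow_left l)
  · rw [Commute, SemiconjBy, mul_pow_eq_smul_pow_mul (lb_mul_ld hq), pow_right_comm, inv_pow, hql]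
    simp
  · rw [Commute, SemiconjBy, mul_pow_eq_smul_pow_mul lc_mul_ld, pow_right_comm, hql]
    simp

theorem aeval_omegaL_mem_center (hq : q ≠ 0) (P : Polynomial ℤ) :
    Polynomial.aeval (omegaL q) P ∈ Subalgebra.center ℂ (Lspec q) := by
  have := AlgHom.map_aeval_int (Subalgebra.center ℂ (Lspec q)).val ⟨_, omegaL_mem_center hq⟩ P
  rw [Subalgebra.coe_val] at this
  exact this ▸ SetLike.coe_mem _

end Lspec

section Representation

/-- Multiplication by the coordinate function. -/
def coordMul : Module.End ℂ (ℂ → ℂ) where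
  toFun f x := x * f x
  map_add' f g := by ext x; simp [mul_add]
  map_smul' r f := by ext x; simp [mul_left_comm]

/-- Precomposition with a dilation, weighted by a scalar. -/
def dilation (β r : ℂ) : Module.End ℂ (ℂ → ℂ) where
  toFun f x := β * f (r * x)
  map_add' f g := by ext x; simp [mul_add]
  map_smul' r f := by ext x; simp [mul_left_comm]

/-- The generators of `𝓛(q)` acting on functions, with `ω` acting as the scalar `w`. -/
def loopGens (q w β : ℂ) : Fin 4 → Module.End ℂ (ℂ → ℂ) :=
  ![(q⁻¹ * w) • 1 - q⁻¹ ^ 2 • coordMul, dilation β (q⁻¹ ^ 2),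
    dilation β⁻¹ (q ^ 2) * loopQuad q (w • 1) coordMul, coordMul]

/-- The representation of `𝓛(q)` on functions on the line in which `d` is multiplication by the
coordinate, `b` is `β` times a `q`-dilation and `ω` is the scalar `w`. -/
def loopRep {q : ℂ} (hq : q ≠ 0) (w : ℂ) {β : ℂ} (hβ : β ≠ 0) :
    Lspec q →ₐ[ℂ] Module.End ℂ (ℂ → ℂ) :=
  RingQuot.liftAlgHom ℂ ⟨FreeAlgebra.lift ℂ (loopGens q w β), by
    have hq1 (x : ℂ) : q ^ 2 * ((q ^ 2)⁻¹ * x) = x := by field_simp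
    have hq2 (x : ℂ) : (q ^ 2)⁻¹ * (q ^ 2 * x) = x := by field_simp
    intro x y h
    induction h <;> refine LinearMap.ext fun f => funext fun x => ?_ <;>
      (try simp only [← Algebra.smul_def]) <;>
      simp [gA, gB, gC, gD, loopGens, coordMul, dilation, loopQuad, hq1, hq2] <;>
      field_simp <;> ring⟩

variable {q : ℂ} (hq : q ≠ 0) (w : ℂ) {β : ℂ} (hβ : β ≠ 0)

theorem loopRep_lift (i : Fin 4) :
    loopRep hq w hβ (RingQuot.mkAlgHom ℂ (LRel ℂ (q ^ 2) ((q ^ 2)⁻¹)) (FreeAlgebra.ι ℂ i)) =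
      loopGens q w β i := by
  refine (RingQuot.liftAlgHom_mkAlgHom_apply ..).trans ?_
  simp

theorem loopRep_la :
    loopRep hq w hβ (la q) = (q⁻¹ * w) • 1 - q⁻¹ ^ 2 • coordMul := loopRep_lift hq w hβ 0

theorem loopRep_lb : loopRep hq w hβ (lb q) = dilation β (q⁻¹ ^ 2) := loopRep_lift hq w hβ 1

theorem loopRep_ld : loopRep hq w hβ (ld q) = coordMul := loopRep_lift hq w hβ 3

theorem loopRep_omegaL : loopRep hq w hβ (omegaL q) = algebraMap ℂ _ w := by
  rw [omegaL_eq, map_add, map_smul, map_smul, loopRep_la, loopRep_ld, Algebra.algebraMap_eq_smul_one]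
  match_scalars <;> field_simp
  simp

theorem coordMul_pow_apply (n : ℕ) (f : ℂ → ℂ) (x : ℂ) : (coordMul ^ n) f x = x ^ n * f x := by
  induction n generalizing f with
  | zero => simp
  | succ n ih => rw [pow_succ, Module.End.mul_apply, ih, coordMul]; simp; ring

theorem dilation_pow_apply (β r : ℂ) (n : ℕ) (f : ℂ → ℂ) (x : ℂ) :
    (dilation β r ^ n) f x = β ^ n * f (r ^ n * x) := by
  induction n generalizing x with
  | zero => simp
  | succ n ih =>
    rw [pow_succ', Module.End.mul_apply, dilation, LinearMap.coe_mk, AddHom.coe_mk]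
    change β * (dilation β r ^ n) f (r * x) = _
    rw [ih]
    ring_nf

theorem lb_pow_mul_lc_pow {l : ℕ} (hodd : Odd l) {ε : ℂ} (hε : IsPrimitiveRoot ε l)
    {P : Polynomial ℤ}
    (hP : ∀ u : ℂ, u ≠ 0 → Polynomial.aeval (u + u⁻¹) P = u ^ l + u⁻¹ ^ l) :
    lb ε ^ l * lc ε ^ l =
      Polynomial.aeval (omegaL ε) P * ld ε ^ l - ld ε ^ l * ld ε ^ l - 1 :=
  have hε0 := hε.ne_zero hodd.pos.ne'
  pow_mul_pow_eq_of_loopQuad hodd hε hP (omegaL_mem_center hε0) (lb_mul_ld hε0) (lb_mul_lc hε0)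

/-- `loopRep ∘ ψ` acts by multiplication operators. -/
theorem loopRep_comp_eq_lmul {l : ℕ} (hodd : Odd l) {ε : ℂ} (hε : IsPrimitiveRoot ε l)
    (hε0 : ε ≠ 0) {P : Polynomial ℤ}
    (hP : ∀ u : ℂ, u ≠ 0 → Polynomial.aeval (u + u⁻¹) P = u ^ l + u⁻¹ ^ l)
    {ψ : MvPolynomial (Fin 4) ℂ →ₐ[ℂ] Lspec ε}
    (h0 : ψ (MvPolynomial.X 0) = Polynomial.aeval (omegaL ε) P - ld ε ^ l)
    (h1 : ψ (MvPolynomial.X 1) = lb ε ^ l)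
    (h2 : ψ (MvPolynomial.X 2) = lc ε ^ l) (h3 : ψ (MvPolynomial.X 3) = ld ε ^ l)
    (p : MvPolynomial (Fin 4) ℂ) (f : ℂ → ℂ) (x : ℂ) :
    loopRep hε0 w hβ (ψ p) f x = MvPolynomial.eval ![Polynomial.aeval w P - x ^ l, β ^ l,
      ((Polynomial.aeval w P - x ^ l) * x ^ l - 1) / β ^ l, x ^ l] p * f x := by
  have hβl : β ^ l ≠ 0 := pow_ne_zero l hβ
  have hd (f : ℂ → ℂ) (x : ℂ) : loopRep hε0 w hβ (ld ε ^ l) f x = x ^ l * f x := by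
    rw [map_pow, loopRep_ld, coordMul_pow_apply]
  have hb (f : ℂ → ℂ) (x : ℂ) : loopRep hε0 w hβ (lb ε ^ l) f x = β ^ l * f x := by
    rw [map_pow, loopRep_lb, dilation_pow_apply, pow_right_comm, inv_pow, hε.pow_eq_one]
    simp
  have hT (f : ℂ → ℂ) (x : ℂ) : loopRep hε0 w hβ (Polynomial.aeval (omegaL ε) P) f x =
      Polynomial.aeval w P * f x := by
    have := AlgHom.map_aeval_int (Algebra.ofId ℂ (Module.End ℂ (ℂ → ℂ))) w P
    rw [AlgHom.map_aeval_int, loopRep_omegaL, ← Algebra.ofId_apply, ← this, Algebra.ofId_apply,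
      Module.algebraMap_end_apply, Pi.smul_apply, smul_eq_mul]
  have hc (f : ℂ → ℂ) (x : ℂ) : loopRep hε0 w hβ (lc ε ^ l) f x =
      ((Polynomial.aeval w P - x ^ l) * x ^ l - 1) / β ^ l * f x := by
    have := congrArg (fun y => loopRep hε0 w hβ y f x) (lb_pow_mul_lc_pow hodd hε hP)
    simp only [map_mul, map_sub, map_one, Module.End.mul_apply, LinearMap.sub_apply,
      Pi.sub_apply, Module.End.one_apply, hb, hd, hT] at this
    field_simp
    linear_combination this
  induction p using MvPolynomial.induction_on generalizing f x with
  | C a =>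
    rw [← MvPolynomial.algebraMap_eq, AlgHom.commutes, AlgHom.commutes,
      Module.algebraMap_end_apply]
    simp
  | add p p' hp hp' =>
    rw [map_add, map_add, LinearMap.add_apply, Pi.add_apply, hp, hp', map_add, add_mul]
  | mul_X p i hp =>
    rw [map_mul, map_mul, Module.End.mul_apply, hp, map_mul, mul_assoc, MvPolynomial.eval_X]
    congr 1
    fin_cases i
    · change loopRep hε0 w hβ (ψ (MvPolynomial.X 0)) f x = (Polynomial.aeval w P - x ^ l) * f x
      rw [h0, map_sub, LinearMap.sub_apply, Pi.sub_apply, hT, hd, sub_mul]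
    · simpa [h1] using hb f x
    · simpa [h2] using hc f x
    · simpa [h3] using hd f x

end Representation

theorem exists_pow_eq_and_add_inv {l : ℕ} (hl : 0 < l) (z : ℂ) :
    ∃ u : ℂ, u ≠ 0 ∧ u ^ l + u⁻¹ ^ l = z := by
  obtain ⟨y, hy0, hy⟩ := exists_add_inv_eq z
  obtain ⟨u, rfl⟩ := IsAlgClosed.exists_pow_nat_eq y hl
  exact ⟨u, by rintro rfl; simp [hl.ne'] at hy0, by rw [inv_pow, hy]⟩

theorem ker_eq_span_detPoly {l : ℕ} (hodd : Odd l) {ε : ℂ} (hε : IsPrimitiveRoot ε l)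
    {P : Polynomial ℤ}
    (hP : ∀ u : ℂ, u ≠ 0 → Polynomial.aeval (u + u⁻¹) P = u ^ l + u⁻¹ ^ l)
    {ψ : MvPolynomial (Fin 4) ℂ →ₐ[ℂ] Lspec ε}
    (h0 : ψ (MvPolynomial.X 0) = Polynomial.aeval (omegaL ε) P - ld ε ^ l)
    (h1 : ψ (MvPolynomial.X 1) = lb ε ^ l)
    (h2 : ψ (MvPolynomial.X 2) = lc ε ^ l) (h3 : ψ (MvPolynomial.X 3) = ld ε ^ l) :
    RingHom.ker (ψ : MvPolynomial (Fin 4) ℂ →+* Lspec ε) = Ideal.span {detPoly} := by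
  have hl := hodd.pos
  have hε0 := hε.ne_zero hl.ne'
  refine le_antisymm (fun p hp => ?_) ?_
  · refine mem_span_detPoly_of_eval_eq_zero fun v hv hdet => ?_
    obtain ⟨x, hx⟩ := IsAlgClosed.exists_pow_nat_eq (v 3) hl
    obtain ⟨β, hβ⟩ := IsAlgClosed.exists_pow_nat_eq (v 1) hl
    obtain ⟨u, hu0, hu⟩ := exists_pow_eq_and_add_inv hl (v 0 + v 3)
    have hβ0 : β ≠ 0 := by rintro rfl; exact hv (by rw [← hβ, zero_pow hl.ne'])
    have key := loopRep_comp_eq_lmul (u + u⁻¹) hβ0 hodd hε hε0 hP h0 h1 h2 h3 p 1 x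
    have hψ : ψ p = 0 := hp
    rw [hψ, hP u hu0, hu, hx, hβ, map_zero, Pi.one_apply, mul_one] at key
    have hvec : ![v 0 + v 3 - v 3, v 1, ((v 0 + v 3 - v 3) * v 3 - 1) / v 1, v 3] = v := by
      ext i
      fin_cases i <;> simp
      field_simp
      linear_combination hdet
    rw [hvec] at key
    exact key.symm
  · rw [Ideal.span_singleton_le_iff_mem, RingHom.mem_ker]
    simp only [detPoly, RingHom.coe_coe, map_sub, map_mul, map_one, h0, h1, h2, h3,
      lb_pow_mul_lc_pow hodd hε hP, sub_mul]
    abel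

theorem MvPolynomial.exists_algHom_of_mem_center {σ k A : Type*} [CommRing k] [Ring A]
    [Algebra k A] {g : σ → A} (hg : ∀ i, g i ∈ Subalgebra.center k A) :
    ∃ ψ : MvPolynomial σ k →ₐ[k] A, ∀ i, ψ (X i) = g i :=
  ⟨(Subalgebra.center k A).val.comp (aeval fun i => ⟨g i, hg i⟩), fun i => by simp⟩

theorem MvPolynomial.range_eq_adjoin {σ k A : Type*} [CommRing k] [Ring A]
    [Algebra k A] (ψ : MvPolynomial σ k →ₐ[k] A) :
    ψ.range = Algebra.adjoin k (Set.range fun i => ψ (X i)) := by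
  rw [← Algebra.map_top, ← adjoin_range_X, AlgHom.map_adjoin, ← Set.range_comp]
  rfl

/-- Let `l ≥ 3` be odd, `ε` a primitive `l`-th root of unity, and `T_l` the
rescaled Chebyshev polynomial of the first kind.  Let `Z₀` be the unital ℂ-subalgebra of
𝓛(ε) generated by `T_l(ω) − dˡ, bˡ, cˡ, dˡ`.  Then `Z₀` is contained in the center of
𝓛(ε); the ℂ-algebra homomorphism `ψ : ℂ[x₁,x₂,x₃,x₄] → 𝓛(ε)` determined by
`ψ(x₁) = T_l(ω) − dˡ`, `ψ(x₂) = bˡ`, `ψ(x₃) = cˡ`, `ψ(x₄) = dˡ` exists, has image `Z₀` and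
kernel the ideal generated by `x₁x₄ − x₂x₃ − 1`; consequently `Z₀` is isomorphic as a
ℂ-algebra to `𝓞(SL₂(ℂ)) = ℂ[x₁,x₂,x₃,x₄]/(x₁x₄ − x₂x₃ − 1)`. -/
theorem stmt_6 (l : ℕ) (hodd : Odd l) (hl : 3 ≤ l) (ε : ℂ) (hε : IsPrimitiveRoot ε l)
    (P : Polynomial ℤ)
    (hP : ∀ u : ℂ, u ≠ 0 → Polynomial.aeval (u + u⁻¹) P = u ^ l + u⁻¹ ^ l) :
    ((Algebra.adjoin ℂ {Polynomial.aeval (omegaL ε) P - ld ε ^ l,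
        lb ε ^ l, lc ε ^ l, ld ε ^ l} : Subalgebra ℂ (Lspec ε)) : Set (Lspec ε)) ⊆
      (Subring.center (Lspec ε) : Set (Lspec ε)) ∧
    (∃ ψ : MvPolynomial (Fin 4) ℂ →ₐ[ℂ] Lspec ε,
        ψ (MvPolynomial.X 0) = Polynomial.aeval (omegaL ε) P - ld ε ^ l ∧
        ψ (MvPolynomial.X 1) = lb ε ^ l ∧
        ψ (MvPolynomial.X 2) = lc ε ^ l ∧ ψ (MvPolynomial.X 3) = ld ε ^ l) ∧
    (∀ ψ : MvPolynomial (Fin 4) ℂ →ₐ[ℂ] Lspec ε,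
      ψ (MvPolynomial.X 0) = Polynomial.aeval (omegaL ε) P - ld ε ^ l →
      ψ (MvPolynomial.X 1) = lb ε ^ l →
      ψ (MvPolynomial.X 2) = lc ε ^ l → ψ (MvPolynomial.X 3) = ld ε ^ l →
      Set.range ψ = ((Algebra.adjoin ℂ {Polynomial.aeval (omegaL ε) P - ld ε ^ l,
          lb ε ^ l, lc ε ^ l, ld ε ^ l} : Subalgebra ℂ (Lspec ε)) : Set (Lspec ε)) ∧
      RingHom.ker (ψ : MvPolynomial (Fin 4) ℂ →+* Lspec ε) =
        Ideal.span {MvPolynomial.X 0 * MvPolynomial.X 3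
          - MvPolynomial.X 1 * MvPolynomial.X 2 - 1}) ∧
    Nonempty ((Algebra.adjoin ℂ {Polynomial.aeval (omegaL ε) P - ld ε ^ l,
        lb ε ^ l, lc ε ^ l, ld ε ^ l} : Subalgebra ℂ (Lspec ε)) ≃ₐ[ℂ]
      (MvPolynomial (Fin 4) ℂ ⧸ Ideal.span {MvPolynomial.X 0 * MvPolynomial.X 3
        - MvPolynomial.X 1 * MvPolynomial.X 2 - (1 : MvPolynomial (Fin 4) ℂ)})) := by
  have hl0 : 0 < l := hodd.pos
  have hε0 : ε ≠ 0 := hε.ne_zero hl0.ne'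
  have hε1 : ε ^ l = 1 := hε.pow_eq_one
  set S : Set (Lspec ε) := {Polynomial.aeval (omegaL ε) P - ld ε ^ l,
    lb ε ^ l, lc ε ^ l, ld ε ^ l} with hS
  have hSc : S ⊆ Subalgebra.center ℂ (Lspec ε) := by
    rintro x (rfl | rfl | rfl | rfl)
    · exact sub_mem (aeval_omegaL_mem_center hε0 P) (ld_pow_mem_center hε0 hε1)
    · exact lb_pow_mem_center hl0 hε0 hε1
    · exact lc_pow_mem_center hl0 hε0 hε1
    · exact ld_pow_mem_center hε0 hε1
  have hrange (ψ : MvPolynomial (Fin 4) ℂ →ₐ[ℂ] Lspec ε)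
      (h0 : ψ (MvPolynomial.X 0) = Polynomial.aeval (omegaL ε) P - ld ε ^ l)
      (h1 : ψ (MvPolynomial.X 1) = lb ε ^ l)
      (h2 : ψ (MvPolynomial.X 2) = lc ε ^ l) (h3 : ψ (MvPolynomial.X 3) = ld ε ^ l) :
      ψ.range = Algebra.adjoin ℂ S := by
    rw [MvPolynomial.range_eq_adjoin, hS]
    congr 1
    ext x
    simp [Fin.exists_fin_succ, h0, h1, h2, h3, eq_comm]
  obtain ⟨ψ, hψ⟩ := MvPolynomial.exists_algHom_of_mem_center (k := ℂ)
    (g := ![Polynomial.aeval (omegaL ε) P - ld ε ^ l, lb ε ^ l, lc ε ^ l, ld ε ^ l])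
    (fun i => hSc (by fin_cases i <;> simp [hS]))
  refine ⟨fun x hx => Algebra.adjoin_le hSc hx, ⟨ψ, hψ 0, hψ 1, hψ 2, hψ 3⟩,
    fun φ h0 h1 h2 h3 => ⟨?_, ker_eq_span_detPoly hodd hε hP h0 h1 h2 h3⟩, ?_⟩
  · rw [← hrange φ h0 h1 h2 h3, AlgHom.coe_range]
  · have hker := ker_eq_span_detPoly hodd hε hP (hψ 0) (hψ 1) (hψ 2) (hψ 3)
    rw [← hrange ψ (hψ 0) (hψ 1) (hψ 2) (hψ 3)]
    exact ⟨((Ideal.quotientEquivAlgOfEq ℂ hker.symm).trans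
      (Ideal.quotientKerEquivRange ψ)).symm⟩

end
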